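/- arXiv:2309.02846 — 10 statements merged into one kernel-verified Lean document; each statement's English description precedes it below -/
import Mathlib

section
/- Let X be a separable reflexive real Banach space, let μ be a Borel probability measure on X, and let C ⊆ X be a bounded, weakly closed, convex set with nonempty interior. Then there exists x₀ ∈ X such that μ(x₀ + C) ≥ μ(x + C) for all x ∈ X. -/
open MeasureTheory

open Filter Topology in
lemma aux_seq {X : Type*} [NormedAddCommGroup X] [NormedSpace ℝ X]
    [TopologicalSpace.SeparableSpace X]
    (hrefl : Function.Surjective (NormedSpace.inclusionInDoubleDual ℝ X))
    (x : ℕ → X) (R : ℝ) (hx : ∀ n, ‖x n‖ ≤ R) :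
    ∃ (a : X) (φ : ℕ → ℕ), StrictMono φ ∧
      Tendsto (fun n => toWeakSpace ℝ X (x (φ n))) atTop (𝓝 (toWeakSpace ℝ X a)) := by
  set S : Set (WeakSpace ℝ X) := toWeakSpace ℝ X '' Metric.closedBall 0 R with hS
  have hK : IsCompact (closure S) := by
    apply NormedSpace.isCompact_closure_of_isBounded
    · rw [hS, Set.preimage_image_eq _ (toWeakSpace ℝ X).injective]
      exact Metric.isBounded_closedBall
    · intro y _
      obtain ⟨z, hz⟩ := hrefl (WeakDual.toStrongDual y)
      refine ⟨toWeakSpace ℝ X z, ?_⟩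
      apply WeakDual.toStrongDual.injective
      rw [← hz]
      rfl
  have hsep : ∃ g : ℕ → StrongDual ℝ X, ∀ z : X, z ≠ 0 → ∃ n, g n z ≠ 0 := by
    choose g hg1 hg2 using fun n => exists_dual_vector'' ℝ (TopologicalSpace.denseSeq X n)
    refine ⟨g, fun z hz => ?_⟩
    have hz' : 0 < ‖z‖ / 2 := by positivity
    obtain ⟨n, hn⟩ := (TopologicalSpace.denseRange_denseSeq X).exists_dist_lt z hz'
    refine ⟨n, fun h0 => ?_⟩
    set d := TopologicalSpace.denseSeq X n
    rw [dist_eq_norm] at hn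
    have h1 : ‖g n (z - d)‖ ≤ ‖z - d‖ := by
      simpa using (g n).le_of_opNorm_le (hg1 n) (z - d)
    have h2 := hg2 n
    have h3 : g n (z - d) = - ‖d‖ := by rw [map_sub, h0, h2]; simp [d]
    rw [h3, norm_neg, norm_norm] at h1
    have := norm_sub_norm_le z d
    linarith
  obtain ⟨g, hg⟩ := hsep
  have : CompactSpace (closure S) := isCompact_iff_compactSpace.mp hK
  have hcont : ∀ f : StrongDual ℝ X,
      Continuous (fun w : WeakSpace ℝ X => f ((toWeakSpace ℝ X).symm w)) := fun f =>
    WeakBilin.eval_continuous (topDualPairing ℝ X).flip f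
  have : TopologicalSpace.MetrizableSpace (closure S) :=
    Metric.PiNatEmbed.TopologicalSpace.MetrizableSpace.of_countable_separating
      (fun n (k : closure S) => g n ((toWeakSpace ℝ X).symm k.1))
      (fun n => (hcont (g n)).comp continuous_subtype_val)
      (fun u v huv => by
        obtain ⟨n, hn⟩ := hg ((toWeakSpace ℝ X).symm u.1 - (toWeakSpace ℝ X).symm v.1)
          (sub_ne_zero.mpr fun h => huv (Subtype.ext ((toWeakSpace ℝ X).symm.injective h)))
        refine ⟨n, fun h => hn ?_⟩
        rw [map_sub, h, sub_self])
  let u : ℕ → closure S := fun n =>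
    ⟨toWeakSpace ℝ X (x n), subset_closure ⟨x n, by simpa using hx n, rfl⟩⟩
  obtain ⟨a, φ, hφ, ha⟩ := SeqCompactSpace.tendsto_subseq u
  refine ⟨(toWeakSpace ℝ X).symm a.1, φ, hφ, ?_⟩
  have := (continuous_subtype_val.tendsto a).comp ha
  rw [LinearEquiv.apply_symm_apply]
  exact this

open Filter Topology in
lemma aux_usc {X : Type*} [NormedAddCommGroup X] [NormedSpace ℝ X]
    [MeasurableSpace X] [BorelSpace X]
    (μ : Measure X) [IsProbabilityMeasure μ]
    (C : Set X) (hCclosed : IsClosed (toWeakSpace ℝ X '' C)) (x : ℕ → X) (a : X)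
    (h : Tendsto (fun n => toWeakSpace ℝ X (x n)) atTop (𝓝 (toWeakSpace ℝ X a))) :
    limsup (fun n => μ ((fun c => x n + c) '' C)) atTop ≤ μ ((fun c => a + c) '' C) := by
  have hC : IsClosed C := by
    have := hCclosed.preimage (toWeakSpaceCLM ℝ X).continuous
    rwa [show ⇑(toWeakSpaceCLM ℝ X) = ⇑(toWeakSpace ℝ X) from rfl,
      Set.preimage_image_eq _ (toWeakSpace ℝ X).injective] at this
  have hm : ∀ y : X, MeasurableSet ((fun c => y + c) '' C) := fun y =>
    ((Homeomorph.addLeft y).isClosedMap _ hC).measurableSet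
  have hmem : ∀ y z : X, z ∈ (fun c => y + c) '' C ↔ z - y ∈ C := by
    intro y z
    constructor
    · rintro ⟨c, hc, rfl⟩; simpa using hc
    · intro hz; exact ⟨z - y, hz, by simp⟩
  have key := limsup_lintegral_le (μ := μ)
    (f := fun n => ((fun c => x n + c) '' C).indicator 1) 1
    (fun n => measurable_one.indicator (hm _))
    (fun n => Eventually.of_forall (Set.indicator_le_self _ _)) (by simp)
  simp only [lintegral_indicator_one (hm _)] at key
  refine key.trans ?_
  rw [← lintegral_indicator_one (hm a)]
  refine lintegral_mono fun y => ?_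
  by_cases hy : y ∈ (fun c => a + c) '' C
  · rw [Set.indicator_of_mem hy]
    exact limsup_le_of_le (by isBoundedDefault)
      (Eventually.of_forall fun n => Set.indicator_le_self _ _ y)
  · have hnot : toWeakSpace ℝ X (y - a) ∉ toWeakSpace ℝ X '' C := by
      rw [(toWeakSpace ℝ X).injective.mem_set_image, ← hmem]
      exact hy
    have ht : Tendsto (fun n => toWeakSpace ℝ X (y - x n)) atTop
        (𝓝 (toWeakSpace ℝ X (y - a))) := by
      simp only [map_sub]
      exact tendsto_const_nhds.sub h
    have hev := ht.eventually (hCclosed.isOpen_compl.mem_nhds hnot)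
    refine limsup_le_of_le (by isBoundedDefault) ?_
    filter_upwards [hev] with n hn
    have : y ∉ (fun c => x n + c) '' C := by
      rw [hmem]
      exact fun hc => hn ⟨_, hc, rfl⟩
    rw [Set.indicator_of_notMem this]
    exact zero_le

/-- **Existence of most likely translates of a convex set** on a separable reflexive
real Banach space: reflexivity is expressed by surjectivity of the canonical embedding
into the double dual, and weak closedness by closedness in the weak topology `σ(X, X*)`. -/
theorem most_likely_translate_exists_of_reflexive
    {X : Type*} [NormedAddCommGroup X] [NormedSpace ℝ X] [CompleteSpace X]
    [TopologicalSpace.SeparableSpace X]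
    (hrefl : Function.Surjective (NormedSpace.inclusionInDoubleDual ℝ X))
    [MeasurableSpace X] [BorelSpace X]
    (μ : Measure X) [IsProbabilityMeasure μ]
    (C : Set X) (hCbdd : Bornology.IsBounded C) (hCconv : Convex ℝ C)
    (hCint : (interior C).Nonempty)
    (hCclosed : IsClosed (toWeakSpace ℝ X '' C)) :
    ∃ x₀ : X, ∀ x : X, μ ((fun c => x + c) '' C) ≤ μ ((fun c => x₀ + c) '' C) := by
  set f : X → ENNReal := fun x => μ ((fun c => x + c) '' C) with hf
  rcases eq_or_ne (⨆ x, f x) 0 with h0 | h0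
  · exact ⟨0, fun x => (le_iSup f x).trans (h0 ▸ zero_le)⟩
  obtain ⟨u, -, hu, hur⟩ := exists_seq_tendsto_sSup (Set.range_nonempty f) (OrderTop.bddAbove _)
  choose x hx using hur
  change Filter.Tendsto u Filter.atTop (nhds (⨆ x, f x)) at hu
  obtain ⟨N, hN⟩ : ∃ N : ℕ, μ (Metric.closedBall 0 N)ᶜ < ⨆ x, f x := by
    have ht := tendsto_measure_iInter_atTop (μ := μ)
      (s := fun n : ℕ => (Metric.closedBall (0 : X) n)ᶜ)
      (fun n => Metric.isClosed_closedBall.measurableSet.compl.nullMeasurableSet)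
      (fun m n hmn => Set.compl_subset_compl.mpr
        (Metric.closedBall_subset_closedBall (by exact_mod_cast hmn)))
      ⟨0, measure_ne_top _ _⟩
    rw [← Set.compl_iUnion, Metric.iUnion_closedBall_nat, Set.compl_univ, measure_empty] at ht
    exact (ht.eventually (gt_mem_nhds (pos_iff_ne_zero.mpr h0))).exists
  obtain ⟨R, hR⟩ := hCbdd.exists_norm_le
  obtain ⟨k, hk⟩ := Filter.eventually_atTop.mp (hu.eventually (lt_mem_nhds hN))
  have hb : ∀ n, ‖x (n + k)‖ ≤ N + R := by
    intro n
    have h1 := hk (n + k) (by omega)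
    rw [← hx] at h1
    have h2 : ¬ ((fun c => x (n + k) + c) '' C ⊆ (Metric.closedBall 0 N)ᶜ) := fun hs =>
      absurd (measure_mono hs) (not_le.mpr h1)
    rw [Set.not_subset] at h2
    obtain ⟨_, ⟨c, hc, rfl⟩, h3⟩ := h2
    have h3 : ‖x (n + k) + c‖ ≤ N := by simpa using h3
    have h4 := norm_sub_le (x (n + k) + c) c
    rw [add_sub_cancel_right] at h4
    linarith [hR c hc]
  obtain ⟨a, φ, hφ, ha⟩ := aux_seq hrefl (fun n => x (n + k)) _ hb
  have hfin := aux_usc μ C hCclosed _ a ha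
  have hlim : Filter.Tendsto (fun n => f (x (φ n + k))) Filter.atTop (nhds (⨆ x, f x)) := by
    simp only [hx]
    exact hu.comp ((Filter.tendsto_add_atTop_nat k).comp hφ.tendsto_atTop)
  rw [show (fun n => μ ((fun c => x (φ n + k) + c) '' C)) = fun n => f (x (φ n + k)) from rfl,
    hlim.limsup_eq] at hfin
  exact ⟨a, fun y => (le_iSup f y).trans hfin⟩
end

section
/- Let X be a separable reflexive real Banach space, let μ be a Borel probability measure on X, and let r > 0. Then there exists x₀ ∈ X such that μ(closedBall(x₀, r)) ≥ μ(closedBall(x, r)) for all x ∈ X; that is, there exists a closed ball of radius r of maximal μ-probability. -/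
open MeasureTheory

open Filter Topology in
/-- Subsequence extraction against countably many functionals. -/
lemma aux_subseq {X : Type*} [NormedAddCommGroup X] [NormedSpace ℝ X]
    (hrefl : Function.Surjective (NormedSpace.inclusionInDoubleDual ℝ X))
    (f : ℕ → StrongDual ℝ X) (x : ℕ → X) (R : ℝ) (hx : ∀ n, ‖x n‖ ≤ R) :
    ∃ (a : X) (φ : ℕ → ℕ), StrictMono φ ∧
      ∀ k, Tendsto (fun n => f k (x (φ n))) atTop (𝓝 (f k a)) := by
  have hK := WeakDual.isCompact_closedBall (𝕜 := ℝ) (0 : StrongDual ℝ (StrongDual ℝ X)) R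
  let Φ : WeakDual ℝ (StrongDual ℝ X) → ℕ → ℝ := fun g k => g (f k)
  have hΦ : Continuous Φ := continuous_pi fun k => WeakDual.eval_continuous (f k)
  have hS := (hK.image hΦ).isSeqCompact
  have hmem : ∀ n, (fun k => f k (x n)) ∈
      Φ '' (WeakDual.toStrongDual ⁻¹' Metric.closedBall (0 : StrongDual ℝ (StrongDual ℝ X)) R) := by
    intro n
    refine ⟨StrongDual.toWeakDual (NormedSpace.inclusionInDoubleDual ℝ X (x n)), ?_, ?_⟩
    · show NormedSpace.inclusionInDoubleDual ℝ X (x n) ∈ Metric.closedBall 0 R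
      refine (mem_closedBall_zero_iff (E := StrongDual ℝ (StrongDual ℝ X))).2 ?_
      exact (NormedSpace.double_dual_bound ℝ X (x n)).trans (hx n)
    · rfl
  obtain ⟨l, ⟨g, -, rfl⟩, φ, hφ, hlim⟩ := hS hmem
  obtain ⟨a, ha⟩ := hrefl (WeakDual.toStrongDual g)
  refine ⟨a, φ, hφ, fun k => ?_⟩
  have h1 := (tendsto_pi_nhds.1 hlim) k
  have h2 : Φ g k = f k a := by
    show (WeakDual.toStrongDual g) (f k) = f k a
    rw [← ha]; rfl
  rw [h2] at h1
  exact h1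

/-- A countable norming family. -/
lemma aux_norming (X : Type*) [NormedAddCommGroup X] [NormedSpace ℝ X]
    [TopologicalSpace.SeparableSpace X] :
    ∃ f : ℕ → StrongDual ℝ X, (∀ k, ‖f k‖ ≤ 1) ∧
      ∀ (z : X) (r : ℝ), (∀ k, f k z ≤ r) → ‖z‖ ≤ r := by
  choose g hg1 hg2 using fun z : X => exists_dual_vector'' ℝ z
  refine ⟨fun k => g (TopologicalSpace.denseSeq X k), fun k => hg1 _, fun z r h => ?_⟩
  refine le_of_forall_pos_le_add fun ε hε => ?_
  obtain ⟨k, hk⟩ := (TopologicalSpace.denseRange_denseSeq X).exists_dist_lt z (half_pos hε)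
  set d := TopologicalSpace.denseSeq X k
  rw [dist_eq_norm] at hk
  have h1 : ‖z‖ ≤ ‖z - d‖ + ‖d‖ := by simpa using norm_add_le (z - d) d
  have h2 : g d d = ‖d‖ := hg2 d
  have h3 : |g d (z - d)| ≤ ‖z - d‖ := by
    have := (g d).le_of_opNorm_le (hg1 d) (z - d)
    simpa using this
  have h4 : g d z ≤ r := h k
  rw [map_sub] at h3
  have := (abs_le.1 h3).1
  linarith

open Filter Topology in
/-- **Existence of a closed ball of maximal probability** for a Borel probability
measure on a separable reflexive real Banach space: reflexivity is expressed by
surjectivity of the canonical embedding into the double dual. -/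
theorem most_likely_ball_exists_of_reflexive
    {X : Type*} [NormedAddCommGroup X] [NormedSpace ℝ X] [CompleteSpace X]
    [TopologicalSpace.SeparableSpace X]
    (hrefl : Function.Surjective (NormedSpace.inclusionInDoubleDual ℝ X))
    [MeasurableSpace X] [BorelSpace X]
    (μ : Measure X) [IsProbabilityMeasure μ]
    (r : ℝ) (hr : 0 < r) :
    ∃ x₀ : X, ∀ x : X, μ (Metric.closedBall x r) ≤ μ (Metric.closedBall x₀ r) := by
  obtain ⟨u, -, hu, huS⟩ := exists_seq_tendsto_sSup
    (S := Set.range fun x : X => μ (Metric.closedBall x r)) (Set.range_nonempty _)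
    (OrderTop.bddAbove _)
  set M := sSup (Set.range fun x : X => μ (Metric.closedBall x r)) with hM
  have hle : ∀ x, μ (Metric.closedBall x r) ≤ M := fun x => le_sSup ⟨x, rfl⟩
  suffices ∃ x₀, M ≤ μ (Metric.closedBall x₀ r) by
    obtain ⟨x₀, h⟩ := this
    exact ⟨x₀, fun x => (hle x).trans h⟩
  rcases eq_or_ne M 0 with h0 | h0
  · exact ⟨0, by simp [h0]⟩
  have hMpos : 0 < M := pos_iff_ne_zero.2 h0
  choose x hx using huS
  -- tightness
  have htail : Tendsto (μ ∘ fun n : ℕ => (Metric.closedBall (0 : X) n)ᶜ) atTop (𝓝 0) := by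
    have := tendsto_measure_iInter_atTop (μ := μ)
      (s := fun n : ℕ => (Metric.closedBall (0 : X) n)ᶜ)
      (fun n => Metric.isClosed_closedBall.measurableSet.compl.nullMeasurableSet)
      (fun m n h => Set.compl_subset_compl.2
        (Metric.closedBall_subset_closedBall (by exact_mod_cast h)))
      ⟨0, measure_ne_top _ _⟩
    rwa [← Set.compl_iUnion, Metric.iUnion_closedBall_nat, Set.compl_univ,
      measure_empty] at this
  obtain ⟨R, hR⟩ := (htail.eventually_lt_const hMpos).exists
  obtain ⟨N, hN⟩ := eventually_atTop.1 (hu.eventually_const_lt hR)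
  have hbd : ∀ n, ‖x (n + N)‖ ≤ R + r := by
    intro n
    by_contra! hcon
    have h1 := hN (n + N) (by omega)
    rw [← hx] at h1
    refine absurd h1 (not_lt.2 (measure_mono ?_))
    intro y hy
    rw [Metric.mem_closedBall, dist_eq_norm] at hy
    simp only [Set.mem_compl_iff, mem_closedBall_zero_iff, not_le]
    have : ‖x (n + N)‖ ≤ ‖y‖ + ‖y - x (n + N)‖ := by
      simpa using norm_sub_le y (y - x (n + N))
    linarith
  obtain ⟨f, hf1, hf2⟩ := aux_norming X
  obtain ⟨a, φ, hφ, hlim⟩ := aux_subseq hrefl f (fun n => x (n + N)) _ hbd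
  refine ⟨a, ?_⟩
  let B : ℕ → Set X := fun n => Metric.closedBall (x (φ n + N)) r
  let s : ℕ → Set X := fun n => ⋃ m ≥ n, B m
  have hs : Tendsto (μ ∘ s) atTop (𝓝 (μ (⋂ n, s n))) := by
    refine tendsto_measure_iInter_atTop (fun n => ?_) (fun m n h => ?_) ⟨0, measure_ne_top _ _⟩
    · exact (MeasurableSet.iUnion fun m => MeasurableSet.iUnion fun _ =>
        Metric.isClosed_closedBall.measurableSet).nullMeasurableSet
    · exact Set.biUnion_subset_biUnion_left fun k (hk : n ≤ k) => h.trans hk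
  have hB : Tendsto (fun n => μ (B n)) atTop (𝓝 M) := by
    have h1 : Tendsto (fun n => φ n + N) atTop atTop :=
      tendsto_atTop_mono (fun n => Nat.le_add_right _ _) hφ.tendsto_atTop
    refine (hu.comp h1).congr fun n => ?_
    exact (hx _).symm
  have hMle : M ≤ μ (⋂ n, s n) := le_of_tendsto_of_tendsto' hB hs fun n =>
    measure_mono (Set.subset_biUnion_of_mem (u := B) (show n ∈ {m | m ≥ n} from le_refl n))
  refine hMle.trans (measure_mono fun y hy => ?_)
  rw [Metric.mem_closedBall, dist_eq_norm]
  refine hf2 _ _ fun k => ?_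
  have hfreq : ∃ᶠ n in atTop, f k y - f k (x (φ n + N)) ≤ r := by
    rw [frequently_atTop]
    intro n
    have h1 := Set.mem_iInter.1 hy n
    simp only [s, Set.mem_iUnion] at h1
    obtain ⟨m, hm, hym⟩ := h1
    refine ⟨m, hm, ?_⟩
    have h2 : ‖y - x (φ m + N)‖ ≤ r := by
      rw [← dist_eq_norm]; exact hym
    have h3 := (f k).le_of_opNorm_le (hf1 k) (y - x (φ m + N))
    rw [map_sub, Real.norm_eq_abs, one_mul] at h3
    exact (le_abs_self _).trans (h3.trans h2)
  rw [map_sub]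
  exact le_of_tendsto_of_frequently ((hlim k).const_sub (f k y)) hfreq
end

section
/- Let X be a real normed space, μ a Borel probability measure on X, and C ⊆ X a bounded set containing 0. Set m₀ := sup{μ(x + C) : x ∈ X} and assume m₀ > 0. Let R > 0 satisfy μ(X \ closedBall(0, R)) ≤ m₀/2, and let (xₙ) be a sequence in X with μ(xₙ + C) → m₀. Then for all sufficiently large n one has ‖xₙ‖ ≤ R + diam(C). -/
open MeasureTheory Filter
open scoped ENNReal

/-- Any maximizing sequence of translates of a bounded set containing `0` is
eventually norm-bounded by `R + diam C`, where `R` captures all but `m₀/2` of the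
total mass. -/
theorem maximizing_sequence_eventually_bounded
    {X : Type*} [NormedAddCommGroup X] [NormedSpace ℝ X]
    [MeasurableSpace X] [BorelSpace X]
    (μ : Measure X) [IsProbabilityMeasure μ]
    (C : Set X) (hCbdd : Bornology.IsBounded C) (hC0 : (0 : X) ∈ C)
    (m₀ : ℝ≥0∞) (hm₀ : m₀ = ⨆ x : X, μ ((fun c => x + c) '' C)) (hm₀pos : 0 < m₀)
    (R : ℝ) (hR : 0 < R) (hRμ : μ (Metric.closedBall (0 : X) R)ᶜ ≤ m₀ / 2)
    (x : ℕ → X)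
    (hx : Tendsto (fun n => μ ((fun c => x n + c) '' C)) atTop (nhds m₀)) :
    ∀ᶠ n in atTop, ‖x n‖ ≤ R + Metric.diam C := by
  have hle : m₀ ≤ 1 := by
    rw [hm₀]
    exact iSup_le fun _ => prob_le_one
  have hlt : m₀ / 2 < m₀ :=
    ENNReal.half_lt_self hm₀pos.ne' (ne_top_of_le_ne_top ENNReal.one_ne_top hle)
  filter_upwards [hx.eventually_const_lt hlt] with n hn
  by_contra! hcon
  refine absurd hn (not_lt.mpr (le_trans (measure_mono ?_) hRμ))
  rintro _ ⟨c, hc, rfl⟩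
  have h1 : ‖c‖ ≤ Metric.diam C := by
    simpa using Metric.dist_le_diam_of_mem hCbdd hc hC0
  have h2 : ‖x n‖ ≤ ‖x n + c‖ + ‖c‖ := by
    simpa using norm_sub_le (x n + c) c
  simp only [Set.mem_compl_iff, Metric.mem_closedBall, dist_zero_right, not_le]
  linarith
end

section
/- Let E be a metric space, let μ be a finite Borel measure on E, let (Aₙ) be a sequence of Borel subsets of E, and suppose the restricted measures νₙ := μ restricted to Aₙ converge weakly (in duality with bounded continuous functions) to a finite Borel measure ν. Then ν ≤ μ, i.e., ν(B) ≤ μ(B) for every Borel set B ⊆ E. -/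
open MeasureTheory Filter

/-- If restrictions `μ|_{Aₙ}` of a finite Borel measure `μ` on a metric space converge
weakly (in duality with bounded continuous functions) to a finite measure `ν`,
then `ν ≤ μ`. -/
theorem weak_limit_of_restrictions_le
    {E : Type*} [MetricSpace E] [MeasurableSpace E] [BorelSpace E]
    (μ : Measure E) [IsFiniteMeasure μ]
    (A : ℕ → Set E) (hA : ∀ n, MeasurableSet (A n))
    (ν : Measure E) [IsFiniteMeasure ν]
    (hconv : ∀ f : BoundedContinuousFunction E ℝ,
      Tendsto (fun n => ∫ x, f x ∂(μ.restrict (A n))) atTop (nhds (∫ x, f x ∂ν))) :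
    ν ≤ μ := by
  have key : ∀ f : BoundedContinuousFunction E ℝ, (∀ x, 0 ≤ f x) →
      ∫ x, f x ∂ν ≤ ∫ x, f x ∂μ := by
    intro f hf
    refine le_of_tendsto' (hconv f) fun n => ?_
    exact integral_mono_measure Measure.restrict_le_self
      (Eventually.of_forall hf) (f.integrable μ)
  have hclosed : ∀ F : Set E, IsClosed F → ν F ≤ μ F := by
    intro F hF
    have hpos : ∀ n : ℕ, (0 : ℝ) < 1 / ((n : ℝ) + 1) := fun n => Nat.one_div_pos_of_nat
    have hlim := tendsto_one_div_add_atTop_nhds_zero_nat (𝕜 := ℝ)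
    have h1 := tendsto_integral_thickenedIndicator_of_isClosed ν hF hpos hlim
    have h2 := tendsto_integral_thickenedIndicator_of_isClosed μ hF hpos hlim
    have h3 : ν.real F ≤ μ.real F := by
      refine le_of_tendsto_of_tendsto' h1 h2 fun n => ?_
      exact key (BoundedContinuousFunction.ofNormedAddCommGroup
        (fun x => (thickenedIndicator (hpos n) F x : ℝ))
        (NNReal.continuous_coe.comp (thickenedIndicator (hpos n) F).continuous) 1
        (fun x => by simpa using thickenedIndicator_le_one (hpos n) F x))
        (fun x => NNReal.coe_nonneg _)
    exact (ENNReal.toReal_le_toReal (measure_ne_top _ _) (measure_ne_top _ _)).1 h3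
  refine Measure.le_iff.2 fun B hB => ?_
  rw [hB.measure_eq_iSup_isClosed_of_ne_top (measure_ne_top ν B)]
  exact iSup_le fun K => iSup_le fun hK => iSup_le fun hc =>
    (hclosed K hc).trans (measure_mono hK)
end

section
/- Let μ = ⊗_{k≥1} Exp(k) be the countable product on ℝ^ℕ of exponential distributions, where the k-th factor has rate k. Then μ({x ∈ ℝ^ℕ : x_k → 0 as k → ∞}) = 1. -/
open MeasureTheory Filter ProbabilityTheory

lemma aux_Iic {r : ℝ} (hr : 0 < r) (x : ℝ) (hx : 0 ≤ x) :
    expMeasure r (Set.Ioi x) = ENNReal.ofReal (Real.exp (-(r * x))) := by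
  haveI := isProbabilityMeasure_expMeasure hr
  have h := cdf_expMeasure_eq hr x
  rw [if_pos hx, cdf_eq_real] at h
  have h2 := probReal_compl_eq_one_sub (μ := expMeasure r) (measurableSet_Iic (a := x))
  rw [h, Set.compl_Iic] at h2
  rw [← ofReal_measureReal, h2]
  congr 1
  ring

lemma aux_zero {r : ℝ} (hr : 0 < r) : expMeasure r (Set.Iic 0) = 0 := by
  haveI := isProbabilityMeasure_expMeasure hr
  have h := cdf_expMeasure_eq hr 0
  rw [if_pos le_rfl, cdf_eq_real] at h
  rw [← ofReal_measureReal, h]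
  simp

theorem exp_product_ae_tendsto_zero
    (μ : Measure (ℕ → ℝ)) [IsProbabilityMeasure μ]
    (hμ : ∀ n : ℕ, Measure.map (fun x (i : Fin n) => x i) μ
      = Measure.pi (fun i : Fin n => expMeasure ((i : ℕ) + 1))) :
    μ {x : ℕ → ℝ | Tendsto x atTop (nhds 0)} = 1 := by
  have hpos : ∀ k : ℕ, (0 : ℝ) < (k : ℝ) + 1 := fun k => by positivity
  have hm : ∀ k : ℕ, Measure.map (fun x : ℕ → ℝ => x k) μ = expMeasure ((k : ℝ) + 1) := by
    intro k
    haveI : ∀ i : Fin (k + 1), IsProbabilityMeasure (expMeasure (((i : ℕ) : ℝ) + 1)) :=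
      fun i => isProbabilityMeasure_expMeasure (hpos _)
    have h1 := (measurePreserving_eval (fun i : Fin (k + 1) => expMeasure (((i : ℕ) : ℝ) + 1))
      (Fin.last k)).map_eq
    rw [← hμ (k + 1), Measure.map_map (measurable_pi_apply _) (by fun_prop)] at h1
    simpa [Function.comp_def] using h1
  have hset : ∀ (k : ℕ) (s : Set ℝ), MeasurableSet s →
      μ {x | x k ∈ s} = expMeasure ((k : ℝ) + 1) s := by
    intro k s hs
    rw [← hm k, Measure.map_apply (measurable_pi_apply k) hs]
    rfl
  have h0 : ∀ᵐ x ∂μ, ∀ k : ℕ, 0 < x k := by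
    rw [ae_all_iff]
    intro k
    have := hset k _ (measurableSet_Iic (a := (0 : ℝ)))
    rw [aux_zero (hpos k)] at this
    rw [ae_iff]
    simpa using this
  have h1 : ∀ᵐ x ∂μ, ∀ m : ℕ, ∀ᶠ k in atTop, x k ≤ 1 / ((m : ℝ) + 1) := by
    rw [ae_all_iff]
    intro m
    set e : ℝ := 1 / ((m : ℝ) + 1) with he
    have hep : 0 < e := by positivity
    have hs : Summable (fun k : ℕ => Real.exp (-(((k : ℝ) + 1) * e))) := by
      have := (Real.summable_exp_nat_mul_iff (a := -e)).2 (by linarith)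
      refine (this.mul_left (Real.exp (-e))).congr fun k => ?_
      rw [← Real.exp_add]
      congr 1
      ring
    have hf : (∑' k : ℕ, μ {x : ℕ → ℝ | x k ∈ Set.Ioi e}) ≠ ⊤ := by
      simp_rw [fun k => hset k _ (measurableSet_Ioi (a := e)),
        fun k : ℕ => aux_Iic (hpos k) e hep.le]
      exact hs.tsum_ofReal_ne_top
    filter_upwards [ae_eventually_notMem hf] with x hx
    filter_upwards [hx] with k hk
    simpa using hk
  have h2 : ∀ᵐ x ∂μ, Tendsto x atTop (nhds 0) := by
    filter_upwards [h0, h1] with x hx0 hx1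
    rw [Metric.tendsto_atTop']
    intro ε hε
    obtain ⟨m, hm⟩ := exists_nat_one_div_lt hε
    obtain ⟨N, hN⟩ := eventually_atTop.1 (hx1 m)
    refine ⟨N, fun n hn => ?_⟩
    rw [Real.dist_eq, sub_zero, abs_of_pos (hx0 n)]
    exact (hN n hn.le).trans_lt hm
  exact (measure_congr (eventuallyEq_univ.2 h2)).trans measure_univ
end

section
/- For all real numbers λ > 0, r > 0 and c ∈ ℝ, one has e^{−λ (c − r)⁺} − e^{−λ (c + r)⁺} ≤ 1 − e^{−2λ r}, with equality if and only if c = r. Equivalently, for a random variable Y with distribution Exp(λ), the probability P(|Y − c| ≤ r) is uniquely maximized over c ∈ ℝ at c = r, with maximal value 1 − e^{−2λ r}. -/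
open MeasureTheory ProbabilityTheory Real

lemma exp_aux (l r c : ℝ) (hl : 0 < l) (hr : 0 < r) (hc : c ≠ r) :
    exp (-(l * max (c - r) 0)) - exp (-(l * max (c + r) 0)) < 1 - exp (-(2 * l * r)) := by
  have hlr : 0 < l * r := mul_pos hl hr
  have h1 : exp (-(2 * l * r)) < 1 := by
    rw [exp_lt_one_iff]; linarith
  rcases lt_or_gt_of_ne hc with h | h
  · rw [max_eq_right (by linarith : c - r ≤ 0)]
    have : exp (-(2 * l * r)) < exp (-(l * max (c + r) 0)) := by
      rw [exp_lt_exp]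
      have : max (c + r) 0 < 2 * r := max_lt (by linarith) (by linarith)
      nlinarith
    simp only [mul_zero, neg_zero, exp_zero]
    linarith
  · rw [max_eq_left (by linarith : 0 ≤ c - r), max_eq_left (by linarith : 0 ≤ c + r)]
    have e : exp (-(l * (c + r))) = exp (-(l * (c - r))) * exp (-(2 * l * r)) := by
      rw [← exp_add]; congr 1; ring
    have h2 : exp (-(l * (c - r))) < 1 := by
      rw [exp_lt_one_iff]; nlinarith
    rw [e]
    nlinarith

lemma exp_aux_eq (l r : ℝ) (hr : 0 < r) :
    exp (-(l * max (r - r) 0)) - exp (-(l * max (r + r) 0)) = 1 - exp (-(2 * l * r)) := by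
  rw [max_eq_left (by linarith : 0 ≤ r + r)]
  simp only [sub_self, max_self, mul_zero, neg_zero, exp_zero]
  congr 2; ring

lemma exp_meas (l r c : ℝ) (hl : 0 < l) (hr : 0 < r) :
    (expMeasure l {y : ℝ | |y - c| ≤ r}).toReal =
      exp (-(l * max (c - r) 0)) - exp (-(l * max (c + r) 0)) := by
  have := isProbabilityMeasure_expMeasure hl
  have hna : NullSingletonClass (expMeasure l) := by
    unfold expMeasure gammaMeasure
    infer_instance
  have hs : {y : ℝ | |y - c| ≤ r} = Set.Icc (c - r) (c + r) := by
    ext y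
    simp only [Set.mem_ofPred_eq, Set.mem_Icc, abs_le]
    constructor <;> rintro ⟨h1, h2⟩ <;> constructor <;> linarith
  have hcdf : ∀ x, (expMeasure l).real (Set.Iic x) = 1 - exp (-(l * max x 0)) := by
    intro x
    rw [← cdf_eq_real, cdf_expMeasure_eq hl]
    split_ifs with h
    · rw [max_eq_left h]
    · rw [max_eq_right (by linarith)]; simp
  rw [hs, measure_congr Ioc_ae_eq_Icc.symm, show Set.Ioc (c - r) (c + r) = Set.Iic (c + r) \ Set.Iic (c - r) by ext y; simp [and_comm]]
  change (expMeasure l).real _ = _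
  rw [measureReal_diff (Set.Iic_subset_Iic.2 (by linarith)) measurableSet_Iic, hcdf, hcdf]
  ring

/-- For `λ, r > 0` one has `e^{-λ(c-r)⁺} - e^{-λ(c+r)⁺} ≤ 1 - e^{-2λr}`, with equality
iff `c = r`; equivalently, for `Y ∼ Exp(λ)` the probability `P(|Y - c| ≤ r)` is
uniquely maximized over `c` at `c = r`, with maximal value `1 - e^{-2λr}`. -/
theorem exp_interval_prob_le
    (l r c : ℝ) (hl : 0 < l) (hr : 0 < r) :
    (exp (-(l * max (c - r) 0)) - exp (-(l * max (c + r) 0)) ≤ 1 - exp (-(2 * l * r))) ∧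
    (exp (-(l * max (c - r) 0)) - exp (-(l * max (c + r) 0)) = 1 - exp (-(2 * l * r)) ↔ c = r) ∧
    ((expMeasure l {y : ℝ | |y - c| ≤ r}).toReal ≤ 1 - exp (-(2 * l * r))) ∧
    ((expMeasure l {y : ℝ | |y - c| ≤ r}).toReal = 1 - exp (-(2 * l * r)) ↔ c = r) := by
  rw [exp_meas l r c hl hr]
  have hle : exp (-(l * max (c - r) 0)) - exp (-(l * max (c + r) 0)) ≤ 1 - exp (-(2 * l * r)) := by
    by_cases h : c = r
    · subst h; exact (exp_aux_eq l c hr).le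
    · exact (exp_aux l r c hl hr h).le
  have hiff : exp (-(l * max (c - r) 0)) - exp (-(l * max (c + r) 0)) = 1 - exp (-(2 * l * r)) ↔
      c = r := by
    constructor
    · intro h
      by_contra hc
      exact (exp_aux l r c hl hr hc).ne h
    · rintro rfl; exact exp_aux_eq l c hr
  exact ⟨hle, hiff, hle, hiff⟩
end

section
/- Let μ = ⊗_{k≥1} Exp(k) on ℝ^ℕ, where the k-th factor has rate k, and let r > 0. Let x ∈ ℝ^ℕ with μ(B_r(x)) > 0, and suppose there is an index k₀ with x_{k₀} < r. Define x' ∈ ℝ^ℕ by x'_k = x_k for k ≠ k₀ and x'_{k₀} = r. Then μ(B_r(x')) > μ(B_r(x)). -/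
open MeasureTheory Filter ProbabilityTheory

lemma exp_aux_Iic (c : ℝ) (hc : 0 < c) (t : ℝ) :
    expMeasure c (Set.Iic t) = ENNReal.ofReal (if 0 ≤ t then 1 - Real.exp (-(c * t)) else 0) := by
  haveI := isProbabilityMeasure_expMeasure hc
  rw [← cdf_expMeasure_eq hc, ofReal_cdf]

lemma exp_aux_lt (c : ℝ) (hc : 0 < c) (r x : ℝ) (hr : 0 < r) (hx : x < r) :
    expMeasure c {y | |y - x| ≤ r} < expMeasure c {y | |y - r| ≤ r} := by
  have h1 : expMeasure c {y | |y - x| ≤ r} ≤ expMeasure c (Set.Iic (x + r)) := by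
    apply measure_mono
    intro y hy
    rw [Set.mem_ofPred_eq] at hy
    have := (abs_le.1 hy).2
    simp only [Set.mem_Iic]; linarith
  have h2 : expMeasure c (Set.Iic (2 * r)) ≤ expMeasure c {y | |y - r| ≤ r} := by
    have hs : Set.Iic (2 * r) ⊆ Set.Iic 0 ∪ {y | |y - r| ≤ r} := by
      intro y hy
      simp only [Set.mem_Iic] at hy
      rcases le_total y 0 with h | h
      · exact Or.inl h
      · right
        simp only [Set.mem_ofPred_eq, abs_le]
        constructor <;> linarith
    refine (measure_mono hs).trans ((measure_union_le _ _).trans ?_)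
    rw [exp_aux_Iic c hc 0]
    simp
  refine h1.trans_lt (lt_of_lt_of_le ?_ h2)
  rw [exp_aux_Iic c hc, exp_aux_Iic c hc, if_pos (show (0 : ℝ) ≤ 2 * r by positivity)]
  have h3 : Real.exp (-(c * (2 * r))) < 1 := by
    rw [Real.exp_lt_one_iff]
    have : 0 < c * (2 * r) := by positivity
    linarith
  rw [ENNReal.ofReal_lt_ofReal_iff (by linarith)]
  split_ifs with h
  · have : Real.exp (-(c * (2 * r))) < Real.exp (-(c * (x + r))) := by
      apply Real.exp_lt_exp.2
      nlinarith
    linarith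
  · linarith

lemma exp_aux_fin (μ : Measure (ℕ → ℝ))
    (hμ : ∀ n : ℕ, Measure.map (fun x (i : Fin n) => x i) μ
      = Measure.pi (fun i : Fin n => expMeasure ((i : ℕ) + 1)))
    (S : ℕ → Set ℝ) (hS : ∀ k, MeasurableSet (S k)) (n : ℕ) :
    μ {y | ∀ k < n, y k ∈ S k} = ∏ k ∈ Finset.range n, expMeasure ((k : ℝ) + 1) (S k) := by
  haveI : ∀ i : Fin n, IsProbabilityMeasure (expMeasure (((i : ℕ) : ℝ) + 1)) :=
    fun i => isProbabilityMeasure_expMeasure (by positivity)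
  have hm : MeasurableSet (Set.univ.pi (fun i : Fin n => S i)) :=
    MeasurableSet.univ_pi (fun i => hS i)
  have h := congrArg (fun m => m (Set.univ.pi (fun i : Fin n => S i))) (hμ n)
  rw [Measure.map_apply (by fun_prop) hm, Measure.pi_pi] at h
  rw [← Fin.prod_univ_eq_prod_range (fun k : ℕ => expMeasure ((k : ℝ) + 1) (S k)) n, ← h]
  congr 1
  ext y
  simp only [Set.mem_ofPred_eq, Set.mem_preimage, Set.mem_univ_pi]
  exact ⟨fun H i => H i i.2, fun H k hk => H ⟨k, hk⟩⟩

lemma exp_aux_lim (μ : Measure (ℕ → ℝ)) [IsProbabilityMeasure μ]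
    (S : ℕ → Set ℝ) (hS : ∀ k, MeasurableSet (S k)) :
    Tendsto (fun n : ℕ => μ {y | ∀ k < n, y k ∈ S k}) atTop (nhds (μ {y | ∀ k, y k ∈ S k})) := by
  have he : {y : ℕ → ℝ | ∀ k, y k ∈ S k} = ⋂ n : ℕ, {y | ∀ k < n, y k ∈ S k} := by
    ext y
    simp only [Set.mem_ofPred_eq, Set.mem_iInter]
    exact ⟨fun H _ k _ => H k, fun H k => H (k + 1) k (Nat.lt_succ_self k)⟩
  rw [he]
  apply tendsto_measure_iInter_atTop
  · intro n
    apply MeasurableSet.nullMeasurableSet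
    have : {y : ℕ → ℝ | ∀ k < n, y k ∈ S k} = ⋂ k, ⋂ (_ : k < n), (fun y => y k) ⁻¹' S k := by
      ext y; simp
    rw [this]
    exact MeasurableSet.iInter fun k => MeasurableSet.iInter fun _ => measurable_pi_apply k (hS k)
  · intro m n hmn y hy k hk
    exact hy k (lt_of_lt_of_le hk hmn)
  · exact ⟨0, measure_ne_top _ _⟩

/-- For the countable product `μ = ⊗_{k≥1} Exp(k)` on `ℝ^ℕ`: if a closed sup-norm ball
`B_r(x)` has positive probability and some coordinate of the center satisfies
`x_{k₀} < r`, then raising that coordinate to `r` strictly increases the probability. -/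
theorem exp_product_ball_improve
    (μ : Measure (ℕ → ℝ)) [IsProbabilityMeasure μ]
    (hμ : ∀ n : ℕ, Measure.map (fun x (i : Fin n) => x i) μ
      = Measure.pi (fun i : Fin n => expMeasure ((i : ℕ) + 1)))
    (r : ℝ) (hr : 0 < r) (x : ℕ → ℝ)
    (hpos : 0 < μ {y : ℕ → ℝ | ∀ k, |y k - x k| ≤ r})
    (k₀ : ℕ) (hk₀ : x k₀ < r) :
    μ {y : ℕ → ℝ | ∀ k, |y k - x k| ≤ r} <
      μ {y : ℕ → ℝ | ∀ k, |y k - Function.update x k₀ r k| ≤ r} := by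
  set S : ℕ → Set ℝ := fun k => {t | |t - x k| ≤ r} with hSdef
  set T : ℕ → Set ℝ := fun k => {t | |t - Function.update x k₀ r k| ≤ r} with hTdef
  have hS : ∀ k, MeasurableSet (S k) := fun k =>
    (isClosed_le (by fun_prop) (by fun_prop)).measurableSet
  have hT : ∀ k, MeasurableSet (T k) := fun k =>
    (isClosed_le (by fun_prop) (by fun_prop)).measurableSet
  have hST : ∀ k, k ≠ k₀ → T k = S k := by
    intro k hk
    simp [hSdef, hTdef, Function.update_of_ne hk]
  have hc : (0 : ℝ) < (k₀ : ℝ) + 1 := by positivity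
  haveI := isProbabilityMeasure_expMeasure hc
  have hlt : expMeasure ((k₀ : ℝ) + 1) (S k₀) < expMeasure ((k₀ : ℝ) + 1) (T k₀) := by
    have := exp_aux_lt _ hc r (x k₀) hr hk₀
    simpa [hSdef, hTdef] using this
  have key : μ {y | ∀ k, y k ∈ S k} * expMeasure ((k₀ : ℝ) + 1) (T k₀)
      = μ {y | ∀ k, y k ∈ T k} * expMeasure ((k₀ : ℝ) + 1) (S k₀) := by
    have l1 := ENNReal.Tendsto.mul_const (b := expMeasure ((k₀ : ℝ) + 1) (T k₀))
      (exp_aux_lim μ S hS) (Or.inr (measure_ne_top _ _))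
    have l2 := ENNReal.Tendsto.mul_const (b := expMeasure ((k₀ : ℝ) + 1) (S k₀))
      (exp_aux_lim μ T hT) (Or.inr (measure_ne_top _ _))
    refine tendsto_nhds_unique (l1.congr' ?_) l2
    filter_upwards [eventually_gt_atTop k₀] with n hn
    rw [exp_aux_fin μ hμ S hS, exp_aux_fin μ hμ T hT,
      ← Finset.mul_prod_erase _ _ (Finset.mem_range.2 hn),
      ← Finset.mul_prod_erase _ (fun k : ℕ => expMeasure ((k : ℝ) + 1) (T k))
        (Finset.mem_range.2 hn)]
    have : ∏ k ∈ (Finset.range n).erase k₀, expMeasure ((k : ℝ) + 1) (T k)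
        = ∏ k ∈ (Finset.range n).erase k₀, expMeasure ((k : ℝ) + 1) (S k) :=
      Finset.prod_congr rfl fun k hk => by rw [hST k (Finset.ne_of_mem_erase hk)]
    rw [this]
    ring
  change μ {y | ∀ k, y k ∈ S k} < μ {y | ∀ k, y k ∈ T k}
  by_contra hcon
  have h1 : μ {y | ∀ k, y k ∈ T k} * expMeasure ((k₀ : ℝ) + 1) (S k₀)
      ≤ μ {y | ∀ k, y k ∈ S k} * expMeasure ((k₀ : ℝ) + 1) (S k₀) :=
    mul_le_mul_left (not_lt.1 hcon) _
  have h2 : μ {y | ∀ k, y k ∈ S k} * expMeasure ((k₀ : ℝ) + 1) (S k₀)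
      < μ {y | ∀ k, y k ∈ S k} * expMeasure ((k₀ : ℝ) + 1) (T k₀) :=
    ENNReal.mul_lt_mul_right hpos.ne' (measure_ne_top _ _) hlt
  exact absurd (key ▸ h2) (not_lt.2 h1)
end

section
/- Let μ = ⊗_{k≥1} Exp(k) on ℝ^ℕ, where the k-th factor has rate k, and let r > 0. Then sup{ μ(B_r(x)) : x ∈ ℝ^ℕ, x_k → 0 } = ∏_{k≥1} (1 − e^{−2 k r}), and this supremum is in particular positive. -/
open MeasureTheory Filter ProbabilityTheory Real

lemma aux_Icc {l : ℝ} (hl : 0 < l) (a b : ℝ) :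
    expMeasure l (Set.Icc a b) = ENNReal.ofReal
      ((if 0 ≤ b then 1 - exp (-(l * b)) else 0) - (if 0 ≤ a then 1 - exp (-(l * a)) else 0)) := by
  have := isProbabilityMeasure_expMeasure hl
  have : NullSingletonClass (expMeasure l) := by
    unfold expMeasure gammaMeasure
    infer_instance
  rw [← cdf_expMeasure_eq hl, ← cdf_expMeasure_eq hl, ← StieltjesFunction.measure_Ioc, measure_cdf]
  exact (measure_congr Ioc_ae_eq_Icc).symm

lemma aux_upper {l r : ℝ} (hl : 0 < l) (hr : 0 < r) (a : ℝ) :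
    expMeasure l (Set.Icc (a - r) (a + r)) ≤ ENNReal.ofReal (1 - exp (-(2 * l * r))) := by
  rw [aux_Icc hl]
  apply ENNReal.ofReal_le_ofReal
  have hq : exp (-(2 * l * r)) ≤ 1 := by
    rw [exp_le_one_iff]; have := mul_pos hl hr; linarith
  by_cases h1 : 0 ≤ a - r
  · have h2 : 0 ≤ a + r := by linarith
    rw [if_pos h1, if_pos h2]
    have e : exp (-(l * (a + r))) = exp (-(l * (a - r))) * exp (-(2 * l * r)) := by
      rw [← exp_add]; congr 1; ring
    have h3 : exp (-(l * (a - r))) ≤ 1 := by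
      rw [exp_le_one_iff]; have := mul_nonneg hl.le h1; linarith
    rw [e]
    nlinarith
  · rw [if_neg h1]
    split_ifs with h2
    · have : exp (-(2 * l * r)) ≤ exp (-(l * (a + r))) := by
        apply exp_le_exp.2; nlinarith
      linarith
    · linarith

lemma aux_at_r {l r : ℝ} (hl : 0 < l) (hr : 0 < r) :
    expMeasure l (Set.Icc (r - r) (r + r)) = ENNReal.ofReal (1 - exp (-(2 * l * r))) := by
  rw [aux_Icc hl, if_pos (by linarith), if_pos (by linarith)]
  congr 1
  rw [sub_self, mul_zero, neg_zero, exp_zero, sub_self, sub_zero]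
  congr 3; ring

lemma aux_at_0 {l r : ℝ} (hl : 0 < l) (hr : 0 < r) :
    expMeasure l (Set.Icc (0 - r) (0 + r)) = ENNReal.ofReal (1 - exp (-(l * r))) := by
  rw [aux_Icc hl, if_pos (by linarith), if_neg (by linarith)]
  simp

lemma aux_fin (μ : Measure (ℕ → ℝ))
    (hμ : ∀ n : ℕ, Measure.map (fun x (i : Fin n) => x i) μ
      = Measure.pi (fun i : Fin n => expMeasure ((i : ℕ) + 1)))
    (r : ℝ) (x : ℕ → ℝ) (n : ℕ) :
    μ {y : ℕ → ℝ | ∀ k < n, |y k - x k| ≤ r}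
      = ∏ k ∈ Finset.range n, expMeasure ((k : ℝ) + 1) (Set.Icc (x k - r) (x k + r)) := by
  have : ∀ i : Fin n, IsProbabilityMeasure (expMeasure (((i : ℕ) : ℝ) + 1)) := fun i =>
    isProbabilityMeasure_expMeasure (by positivity)
  rw [Finset.prod_range (fun k => expMeasure ((k : ℝ) + 1) (Set.Icc (x k - r) (x k + r))),
    ← Measure.pi_pi, ← hμ n, Measure.map_apply (by fun_prop)
      (MeasurableSet.univ_pi fun i => measurableSet_Icc)]
  congr 1
  ext y
  simp only [Set.mem_ofPred_eq, Set.mem_preimage, Set.mem_pi, Set.mem_univ, true_imp_iff,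
    Set.mem_Icc, Fin.forall_iff, abs_le]
  refine forall_congr' fun k => forall_congr' fun _ => ?_
  constructor <;> rintro ⟨h, h'⟩ <;> constructor <;> linarith

lemma aux_lim (μ : Measure (ℕ → ℝ)) [IsProbabilityMeasure μ] (r : ℝ) (x : ℕ → ℝ) :
    Tendsto (fun n => μ {y : ℕ → ℝ | ∀ k < n, |y k - x k| ≤ r}) atTop
      (nhds (μ {y : ℕ → ℝ | ∀ k, |y k - x k| ≤ r})) := by
  have e : {y : ℕ → ℝ | ∀ k, |y k - x k| ≤ r} = ⋂ n : ℕ, {y : ℕ → ℝ | ∀ k < n, |y k - x k| ≤ r} := by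
    ext y
    simp only [Set.mem_ofPred_eq, Set.mem_iInter]
    exact ⟨fun h n k _ => h k, fun h k => h (k+1) k (Nat.lt_succ_self k)⟩
  rw [e]
  apply tendsto_measure_iInter_atTop
  · intro n
    apply MeasurableSet.nullMeasurableSet
    have : {y : ℕ → ℝ | ∀ k < n, |y k - x k| ≤ r}
        = ⋂ k : ℕ, ⋂ _ : k < n, {y : ℕ → ℝ | |y k - x k| ≤ r} := by
      ext y; simp
    rw [this]
    refine MeasurableSet.iInter fun k => MeasurableSet.iInter fun _ => ?_
    exact measurableSet_le (by fun_prop) measurable_const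
  · intro a b hab y hy k hk
    exact hy k (hk.trans_le hab)
  · exact ⟨0, measure_ne_top _ _⟩

/-- tail product lower bound -/
lemma aux_tail {r : ℝ} (hr : 0 < r) (m n : ℕ) :
    1 - exp (-r) ^ (m + 1) * (1 - exp (-r))⁻¹ ≤
      ∏ k ∈ Finset.range n, (1 - exp (-((((m + k : ℕ) : ℝ) + 1) * r))) := by
  have hc0 : 0 < exp (-r) := exp_pos _
  have hc1 : exp (-r) < 1 := by rw [exp_lt_one_iff]; linarith
  have hq : ∀ k : ℕ, exp (-((((m + k : ℕ) : ℝ) + 1) * r)) = exp (-r) ^ (m + k + 1) := by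
    intro k
    rw [← exp_nat_mul]; congr 1; push_cast; ring
  simp only [hq]
  set c := exp (-r)
  have key : ∀ n : ℕ, 1 - ∑ k ∈ Finset.range n, c ^ (m + k + 1) ≤
      ∏ k ∈ Finset.range n, (1 - c ^ (m + k + 1)) ∧
      ∏ k ∈ Finset.range n, (1 - c ^ (m + k + 1)) ≤ 1 := by
    intro n
    induction n with
    | zero => simp
    | succ n ih =>
      rw [Finset.prod_range_succ, Finset.sum_range_succ]
      have h0 : 0 < c ^ (m + n + 1) := by positivity
      have h1 : c ^ (m + n + 1) ≤ 1 := pow_le_one₀ hc0.le hc1.le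
      have hp : 0 ≤ ∏ k ∈ Finset.range n, (1 - c ^ (m + k + 1)) :=
        Finset.prod_nonneg fun k _ => sub_nonneg.2 (pow_le_one₀ hc0.le hc1.le)
      constructor <;> nlinarith [ih.1, ih.2]
  refine le_trans ?_ (key n).1
  have : ∑ k ∈ Finset.range n, c ^ (m + k + 1) = c ^ (m + 1) * ∑ k ∈ Finset.range n, c ^ k := by
    rw [Finset.mul_sum]; refine Finset.sum_congr rfl fun k _ => ?_
    ring
  rw [this]
  have hs : ∑ k ∈ Finset.range n, c ^ k ≤ (1 - c)⁻¹ := by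
    rw [← tsum_geometric_of_lt_one hc0.le hc1]
    exact (summable_geometric_of_lt_one hc0.le hc1).sum_le_tsum _ (fun _ _ => by positivity)
  have : c ^ (m + 1) * ∑ k ∈ Finset.range n, c ^ k ≤ c ^ (m + 1) * (1 - c)⁻¹ := by gcongr
  linarith

lemma aux_lower (μ : Measure (ℕ → ℝ)) [IsProbabilityMeasure μ]
    (hμ : ∀ n : ℕ, Measure.map (fun x (i : Fin n) => x i) μ
      = Measure.pi (fun i : Fin n => expMeasure ((i : ℕ) + 1)))
    (r : ℝ) (hr : 0 < r) (m : ℕ) :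
    ENNReal.ofReal ((∏ k ∈ Finset.range m, (1 - exp (-(2 * ((k : ℝ) + 1) * r)))) *
      (1 - exp (-r) ^ (m + 1) * (1 - exp (-r))⁻¹)) ≤
    ⨆ x : {x : ℕ → ℝ // Tendsto x atTop (nhds 0)},
        μ {y : ℕ → ℝ | ∀ k, |y k - x.1 k| ≤ r} := by
  have hx : Tendsto (fun k : ℕ => if k < m then r else 0) atTop (nhds 0) := by
    apply tendsto_const_nhds.congr'
    filter_upwards [eventually_ge_atTop m] with k hk
    rw [if_neg (by omega)]
  refine le_trans ?_ (le_iSup (fun x : {x : ℕ → ℝ // Tendsto x atTop (nhds 0)} =>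
        μ {y : ℕ → ℝ | ∀ k, |y k - x.1 k| ≤ r}) ⟨_, hx⟩)
  refine ge_of_tendsto (aux_lim μ r _) ?_
  filter_upwards [eventually_ge_atTop m] with n hn
  obtain ⟨j, rfl⟩ := Nat.exists_eq_add_of_le hn
  rw [aux_fin μ hμ, Finset.prod_range_add]
  have hA : ∏ k ∈ Finset.range m, expMeasure ((k : ℝ) + 1)
      (Set.Icc ((if k < m then r else 0) - r) ((if k < m then r else 0) + r))
      = ENNReal.ofReal (∏ k ∈ Finset.range m, (1 - exp (-(2 * ((k : ℝ) + 1) * r)))) := by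
    rw [ENNReal.ofReal_prod_of_nonneg]
    · refine Finset.prod_congr rfl fun k hk => ?_
      rw [if_pos (Finset.mem_range.1 hk), aux_at_r (by positivity) hr]
    · intro k _
      rw [sub_nonneg, exp_le_one_iff, neg_nonpos]; positivity
  have hB : ∏ k ∈ Finset.range j, expMeasure (((m + k : ℕ) : ℝ) + 1)
      (Set.Icc ((if m + k < m then r else 0) - r) ((if m + k < m then r else 0) + r))
      = ENNReal.ofReal (∏ k ∈ Finset.range j, (1 - exp (-((((m + k : ℕ) : ℝ) + 1) * r)))) := by
    rw [ENNReal.ofReal_prod_of_nonneg]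
    · refine Finset.prod_congr rfl fun k hk => ?_
      rw [if_neg (by omega), aux_at_0 (by positivity) hr]
    · intro k _
      rw [sub_nonneg, exp_le_one_iff, neg_nonpos]; positivity
  have h0 : 0 ≤ ∏ k ∈ Finset.range m, (1 - exp (-(2 * ((k : ℝ) + 1) * r))) := by
    refine Finset.prod_nonneg fun k _ => ?_
    rw [sub_nonneg, exp_le_one_iff, neg_nonpos]; positivity
  rw [hA, hB, ← ENNReal.ofReal_mul h0]
  exact ENNReal.ofReal_le_ofReal (mul_le_mul_of_nonneg_left (aux_tail hr m j) h0)

/-- For the countable product `μ = ⊗_{k≥1} Exp(k)` on `ℝ^ℕ` and `r > 0`, the supremum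
over null sequences `x` of `μ(B_r(x))` equals the infinite product
`∏_{k≥1} (1 - e^{-2kr})` (the limit of the partial products), and in particular this
supremum is positive. -/
theorem exp_product_sup_ball_prob
    (μ : Measure (ℕ → ℝ)) [IsProbabilityMeasure μ]
    (hμ : ∀ n : ℕ, Measure.map (fun x (i : Fin n) => x i) μ
      = Measure.pi (fun i : Fin n => expMeasure ((i : ℕ) + 1)))
    (r : ℝ) (hr : 0 < r) :
    Tendsto (fun n => ∏ k ∈ Finset.range n, (1 - exp (-(2 * ((k : ℝ) + 1) * r))))
      atTop (nhds ((⨆ x : {x : ℕ → ℝ // Tendsto x atTop (nhds 0)},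
        μ {y : ℕ → ℝ | ∀ k, |y k - x.1 k| ≤ r}).toReal)) ∧
    0 < ⨆ x : {x : ℕ → ℝ // Tendsto x atTop (nhds 0)},
        μ {y : ℕ → ℝ | ∀ k, |y k - x.1 k| ≤ r} := by
  have hlow := aux_lower μ hμ r hr
  have hup : ∀ n : ℕ, (⨆ x : {x : ℕ → ℝ // Tendsto x atTop (nhds 0)},
        μ {y : ℕ → ℝ | ∀ k, |y k - x.1 k| ≤ r}) ≤
        ENNReal.ofReal (∏ k ∈ Finset.range n, (1 - exp (-(2 * ((k : ℝ) + 1) * r)))) := by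
    intro n
    refine iSup_le fun x => ?_
    refine (measure_mono (s := {y : ℕ → ℝ | ∀ k, |y k - x.1 k| ≤ r}) (t := {y : ℕ → ℝ | ∀ k < n, |y k - x.1 k| ≤ r})
      (fun y hy k _ => hy k)).trans ?_
    rw [aux_fin μ hμ, ENNReal.ofReal_prod_of_nonneg]
    · exact Finset.prod_le_prod' fun k _ => aux_upper (by positivity) hr _
    · intro k _
      rw [sub_nonneg, exp_le_one_iff, neg_nonpos]; positivity
  set S := ⨆ x : {x : ℕ → ℝ // Tendsto x atTop (nhds 0)},
        μ {y : ℕ → ℝ | ∀ k, |y k - x.1 k| ≤ r}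
  set p : ℕ → ℝ := fun n => ∏ k ∈ Finset.range n, (1 - exp (-(2 * ((k : ℝ) + 1) * r))) with hp
  have hS : S ≠ ⊤ := ne_top_of_le_ne_top ENNReal.ofReal_ne_top (hup 0)
  have hppos : ∀ n, 0 < p n := fun n => Finset.prod_pos fun k _ => by
    rw [sub_pos, exp_lt_one_iff, neg_lt_zero]; positivity
  have hup' : ∀ n, S.toReal ≤ p n := fun n => ENNReal.toReal_le_of_le_ofReal (hppos n).le (hup n)
  have hlow' : ∀ n, p n * (1 - exp (-r) ^ (n + 1) * (1 - exp (-r))⁻¹) ≤ S.toReal := fun n =>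
    (ENNReal.ofReal_le_iff_le_toReal hS).1 (hlow n)
  have ht : Tendsto (fun n : ℕ => 1 - exp (-r) ^ (n + 1) * (1 - exp (-r))⁻¹) atTop (nhds 1) := by
    have h1 : Tendsto (fun n : ℕ => exp (-r) ^ (n + 1)) atTop (nhds 0) :=
      (tendsto_pow_atTop_nhds_zero_of_lt_one (exp_pos _).le
        (by rw [exp_lt_one_iff]; linarith)).comp (tendsto_add_atTop_nat 1)
    simpa using (h1.mul_const ((1 - exp (-r))⁻¹)).const_sub 1
  have hpos := ht.eventually (lt_mem_nhds (show (0 : ℝ) < 1 by norm_num))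
  constructor
  · have hlim : Tendsto (fun n : ℕ => S.toReal / (1 - exp (-r) ^ (n + 1) * (1 - exp (-r))⁻¹))
        atTop (nhds S.toReal) := by
      have h := (tendsto_const_nhds (x := S.toReal)).div ht one_ne_zero
      rw [div_one] at h
      exact h
    refine tendsto_of_tendsto_of_tendsto_of_le_of_le' tendsto_const_nhds hlim
      (Eventually.of_forall hup') ?_
    filter_upwards [hpos] with n hn
    rw [le_div_iff₀ hn]
    exact hlow' n
  · obtain ⟨n, hn⟩ := hpos.exists
    exact lt_of_lt_of_le (ENNReal.ofReal_pos.2 (mul_pos (hppos n) hn)) (hlow n)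
end

section
/- Let σ > 0, r > 0 and a ≤ 0 be real numbers, and let γ = N(0, σ²). Then sup{ γ([c − r, c + r] ∩ [a, ∞)) : c ∈ ℝ } = Φ( ((a + r)⁺ + r)/σ ) − Φ( ((a + r)⁺ − r)/σ ), and the supremum is attained exactly at c = (a + r)⁺. -/
open MeasureTheory ProbabilityTheory Real
open scoped NNReal

/-- The standard normal cumulative distribution function `Φ`. -/
noncomputable def stdGaussianCDF (t : ℝ) : ℝ :=
  (ProbabilityTheory.gaussianReal 0 1 (Set.Iic t)).toReal

noncomputable def gF (v : ℝ≥0) (x : ℝ) : ℝ := (gaussianReal 0 v (Set.Iic x)).toReal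

lemma gF_eq (v : ℝ≥0) (hv : v ≠ 0) (x : ℝ) : gF v x = ∫ t in Set.Iic x, gaussianPDFReal 0 v t := by
  rw [gF, gaussianReal_apply_eq_integral 0 hv, ENNReal.toReal_ofReal]
  exact integral_nonneg (fun t => gaussianPDFReal_nonneg _ _ _)

lemma gPDF_cont (v : ℝ≥0) : Continuous (gaussianPDFReal 0 v) := by
  rw [gaussianPDFReal_def]; fun_prop

lemma gF_deriv (v : ℝ≥0) (hv : v ≠ 0) (x : ℝ) : HasDerivAt (gF v) (gaussianPDFReal 0 v x) x := by
  have h : gF v = fun y => (∫ t in (0:ℝ)..y, gaussianPDFReal 0 v t) + gF v 0 := by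
    funext y
    rw [gF_eq v hv y, gF_eq v hv 0, ← intervalIntegral.integral_Iic_sub_Iic
      (integrable_gaussianPDFReal 0 v).integrableOn (integrable_gaussianPDFReal 0 v).integrableOn]
    ring
  rw [h]
  exact (intervalIntegral.integral_hasDerivAt_right ((gPDF_cont v).intervalIntegrable _ _)
    (gPDF_cont v).stronglyMeasurable.stronglyMeasurableAtFilter (gPDF_cont v).continuousAt).add_const _

lemma gF_strictMono (v : ℝ≥0) (hv : v ≠ 0) : StrictMono (gF v) :=
  strictMono_of_hasDerivAt_pos (fun x => gF_deriv v hv x) (fun x => gaussianPDFReal_pos 0 v x hv)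

lemma gF_neg (v : ℝ≥0) (hv : v ≠ 0) (x : ℝ) : gF v (-x) = 1 - gF v x := by
  have : NullSingletonClass (gaussianReal 0 v) := nullSingletonClass_gaussianReal hv
  have h : gF v (-x) = (gaussianReal 0 v).real (Set.Iio x)ᶜ := by
    have h1 := gaussianReal_map_neg (μ := 0) (v := v)
    rw [neg_zero] at h1
    have h2 : gF v (-x) = ((gaussianReal 0 v).map (fun x ↦ -x) (Set.Iic (-x))).toReal := by
      rw [h1, gF]
    rw [h2, Measure.map_apply measurable_neg measurableSet_Iic]
    simp [Measure.real]
  rw [h, probReal_compl_eq_one_sub measurableSet_Iio, gF, Measure.real, measure_congr Iio_ae_eq_Iic]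

lemma gF_Icc (v : ℝ≥0) (hv : v ≠ 0) (x y : ℝ) (h : x ≤ y) :
    (gaussianReal 0 v (Set.Icc x y)).toReal = gF v y - gF v x := by
  have : NullSingletonClass (gaussianReal 0 v) := nullSingletonClass_gaussianReal hv
  rw [← measure_congr Ioc_ae_eq_Icc, show Set.Ioc x y = Set.Iic y \ Set.Iic x by
    ext t; simp [and_comm]]
  exact measureReal_diff (Set.Iic_subset_Iic.2 h) measurableSet_Iic

lemma gF_scale (σ : ℝ) (hσ : 0 < σ) (x : ℝ) : gF (σ.toNNReal ^ 2) x = stdGaussianCDF (x / σ) := by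
  have h1 := gaussianReal_map_const_mul (μ := 0) (v := 1) σ
  have h2 : NNReal.mk (σ ^ 2) (sq_nonneg σ) * 1 = σ.toNNReal ^ 2 := by
    rw [mul_one]; apply NNReal.eq; rw [NNReal.coe_pow, Real.coe_toNNReal _ hσ.le]; rfl
  rw [mul_zero, h2] at h1
  rw [gF, ← h1, Measure.map_apply (by fun_prop) measurableSet_Iic, stdGaussianCDF]
  congr 2
  ext t
  simp [le_div_iff₀ hσ, mul_comm]

lemma gH_anti (v : ℝ≥0) (hv : v ≠ 0) (r : ℝ) (hr : 0 < r) :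
    StrictAntiOn (fun c => gF v (c + r) - gF v (c - r)) (Set.Ici 0) := by
  have hd : ∀ c, HasDerivAt (fun c => gF v (c + r) - gF v (c - r))
      (gaussianPDFReal 0 v (c + r) - gaussianPDFReal 0 v (c - r)) c := fun c =>
    ((gF_deriv v hv (c + r)).comp_add_const c r).sub ((gF_deriv v hv (c - r)).comp_sub_const c r)
  apply strictAntiOn_of_deriv_neg (convex_Ici 0)
  · exact fun c _ => (hd c).continuousAt.continuousWithinAt
  · intro c hc
    rw [interior_Ici, Set.mem_Ioi] at hc
    rw [(hd c).deriv, sub_neg]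
    have hv' : (0:ℝ) < v := by positivity
    simp only [gaussianPDFReal, sub_zero]
    apply mul_lt_mul_of_pos_left _ (by positivity)
    rw [Real.exp_lt_exp]
    apply div_lt_div_of_pos_right _ (by positivity)
    nlinarith [mul_pos hc hr]

lemma gG_lt (v : ℝ≥0) (hv : v ≠ 0) (r a : ℝ) (hr : 0 < r) (c : ℝ)
    (hc : c ≠ max (a + r) 0) :
    ((gaussianReal 0 v) (Set.Icc (c - r) (c + r) ∩ Set.Ici a)).toReal <
      gF v (max (a + r) 0 + r) - gF v (max (a + r) 0 - r) := by
  have hH := gH_anti v hv r hr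
  have hle : ((gaussianReal 0 v) (Set.Icc (c - r) (c + r) ∩ Set.Ici a)).toReal ≤
      gF v (c + r) - gF v (c - r) := by
    rw [← gF_Icc v hv _ _ (by linarith)]
    exact measureReal_mono Set.inter_subset_left
  rcases lt_or_gt_of_ne hc with h | h
  · rcases le_or_gt (a + r) 0 with h0 | h0
    · rw [max_eq_right h0] at h ⊢
      refine hle.trans_lt ?_
      have := hH (Set.mem_Ici.2 le_rfl) (Set.mem_Ici.2 (by linarith : 0 ≤ -c)) (by linarith)
      simp only at this
      rw [show -c + r = -(c - r) by ring, show -c - r = -(c + r) by ring, gF_neg v hv,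
        gF_neg v hv] at this
      linarith
    · rw [max_eq_left h0.le] at h ⊢
      rw [add_sub_cancel_right]
      have h3 := gF_strictMono v hv (show a < a + r + r by linarith)
      have h4 := gF_strictMono v hv (show c + r < a + r + r by linarith)
      have h2 : ((gaussianReal 0 v) (Set.Icc (c - r) (c + r) ∩ Set.Ici a)).toReal ≤
          ((gaussianReal 0 v) (Set.Icc a (c + r))).toReal :=
        measureReal_mono (fun t ht => ⟨ht.2, ht.1.2⟩)
      rcases le_or_gt a (c + r) with h1 | h1
      · rw [gF_Icc v hv _ _ h1] at h2
        linarith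
      · rw [Set.Icc_eq_empty (not_le.2 h1)] at h2
        simp only [measure_empty, ENNReal.toReal_zero] at h2
        linarith
  · exact hle.trans_lt (hH (Set.mem_Ici.2 (le_max_right _ _))
      (Set.mem_Ici.2 ((le_max_right _ _).trans h.le)) h)

lemma gG_eq (v : ℝ≥0) (hv : v ≠ 0) (r a : ℝ) (hr : 0 < r) :
    ((gaussianReal 0 v) (Set.Icc (max (a + r) 0 - r) (max (a + r) 0 + r) ∩ Set.Ici a)).toReal =
      gF v (max (a + r) 0 + r) - gF v (max (a + r) 0 - r) := by
  rw [Set.inter_eq_left.2, gF_Icc v hv _ _ (by linarith)]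
  intro t ht
  have := le_max_left (a + r) 0
  exact Set.mem_Ici.2 (by linarith [ht.1])

/-- For `γ = N(0, σ²)`, `r > 0` and `a ≤ 0`, the probability
`γ([c - r, c + r] ∩ [a, ∞))` is maximized over `c ∈ ℝ` exactly at `c = (a + r)⁺`, with
maximal value `Φ(((a + r)⁺ + r)/σ) - Φ(((a + r)⁺ - r)/σ)`. -/
theorem gaussian_halfline_interval_max
    (σ r a : ℝ) (hσ : 0 < σ) (hr : 0 < r) (ha : a ≤ 0) :
    (∀ c : ℝ,
      ((gaussianReal 0 (σ.toNNReal ^ 2)) (Set.Icc (c - r) (c + r) ∩ Set.Ici a)).toReal ≤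
        stdGaussianCDF ((max (a + r) 0 + r) / σ) - stdGaussianCDF ((max (a + r) 0 - r) / σ)) ∧
    ((gaussianReal 0 (σ.toNNReal ^ 2))
        (Set.Icc (max (a + r) 0 - r) (max (a + r) 0 + r) ∩ Set.Ici a)).toReal =
      stdGaussianCDF ((max (a + r) 0 + r) / σ) - stdGaussianCDF ((max (a + r) 0 - r) / σ) ∧
    ∀ c : ℝ,
      ((gaussianReal 0 (σ.toNNReal ^ 2)) (Set.Icc (c - r) (c + r) ∩ Set.Ici a)).toReal =
        stdGaussianCDF ((max (a + r) 0 + r) / σ) - stdGaussianCDF ((max (a + r) 0 - r) / σ) →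
      c = max (a + r) 0 := by
  have hv : σ.toNNReal ^ 2 ≠ 0 := pow_ne_zero _ (by simpa using hσ)
  rw [← gF_scale σ hσ, ← gF_scale σ hσ]
  have he := gG_eq _ hv r a hr
  refine ⟨fun c => ?_, he, fun c hc => ?_⟩
  · by_cases h : c = max (a + r) 0
    · rw [h]; exact he.le
    · exact (gG_lt _ hv r a hr c h).le
  · by_contra h
    exact (gG_lt _ hv r a hr c h).ne hc
end

section
/- Let μ₀ = ⊗_{k≥1} N(0, 1/k²) on ℝ^ℕ, let A = {x ∈ ℝ^ℕ : x_k ≥ −1/√k for all k}, and let μ = μ₀(A)^{−1} · μ₀ restricted to A be the conditioned probability measure. Let r > 0. Then for every x ∈ ℝ^ℕ with x_k → 0 and μ(B_r(x)) > 0 there exists x' ∈ ℝ^ℕ with x'_k → 0 such that μ(B_r(x')) > μ(B_r(x)). In particular, x ↦ μ(B_r(x)) has no maximizer on the space of null sequences. -/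
open MeasureTheory Filter ProbabilityTheory
open scoped NNReal ENNReal

lemma gcb_eq_infinitePi (μ₀ : Measure (ℕ → ℝ)) (γ : ℕ → Measure ℝ)
    [∀ i, IsProbabilityMeasure (γ i)]
    (h : ∀ n : ℕ, Measure.map (fun x (i : Fin n) => x i) μ₀
      = Measure.pi (fun i : Fin n => γ i)) : μ₀ = Measure.infinitePi γ := by
  classical
  refine Measure.eq_infinitePi γ fun s t ht => ?_
  set n := s.sup id + 1 with hn
  have hs : ∀ i ∈ s, i < n := fun i hi => Nat.lt_succ_of_le (Finset.le_sup (f := id) hi)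
  let t' : ℕ → Set ℝ := fun i => if i ∈ s then t i else Set.univ
  have ht' : ∀ i, MeasurableSet (t' i) := by
    intro i
    by_cases hi : i ∈ s
    · simpa [t', hi] using ht i
    · simp [t', hi]
  have e : Set.pi (s : Set ℕ) t = (fun (x : ℕ → ℝ) (i : Fin n) => x i) ⁻¹'
      (Set.univ.pi fun i : Fin n => t' i) := by
    ext x
    simp only [Set.mem_pi, Finset.mem_coe, Set.mem_preimage, Set.mem_univ, true_imp_iff]
    constructor
    · intro hx i
      by_cases hi : (i : ℕ) ∈ s
      · simpa [t', hi] using hx i hi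
      · simp [t', hi]
    · intro hx i hi
      have := hx ⟨i, hs i hi⟩
      simpa [t', hi] using this
  rw [e, ← Measure.map_apply (by fun_prop) (MeasurableSet.univ_pi fun i : Fin n => ht' i), h,
    Measure.pi_pi, Fin.prod_univ_eq_prod_range (fun i => γ i (t' i))]
  symm
  apply Finset.prod_subset_one_on_sdiff
  · intro i hi
    simpa using hs i hi
  · intro i hi
    have : i ∉ s := (Finset.mem_sdiff.1 hi).2
    simp [t', this]
  · intro i hi
    simp [t', hi]

lemma gcb_pos (γ : ℕ → Measure ℝ) [∀ i, IsProbabilityMeasure (γ i)] (k : ℕ)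
    (S : ℕ → Set ℝ) (hS : ∀ i, MeasurableSet (S i)) (I : Set ℝ) (hI : MeasurableSet I)
    (h1 : 0 < Measure.infinitePi γ {y | ∀ j, j ≠ k → y j ∈ S j}) (h2 : 0 < γ k I) :
    0 < Measure.infinitePi γ ({y | ∀ j, j ≠ k → y j ∈ S j} ∩ {y | y k ∈ I}) := by
  have hi : iIndepFun (fun (i : ℕ) (y : ℕ → ℝ) => y i) (Measure.infinitePi γ) :=
    iIndepFun_infinitePi (X := fun _ x => x) (fun i => measurable_id)
  have hd : Disjoint ({k}ᶜ : Set ℕ) {k} := disjoint_compl_left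
  have H := indep_iSup_of_disjoint
    (fun i => (measurable_pi_apply i : Measurable fun y : ℕ → ℝ => y i).comap_le) hi.iIndep hd
  rw [Indep_iff] at H
  rw [H]
  · have : Measure.infinitePi γ {y | y k ∈ I} = γ k I := by
      rw [← Measure.infinitePi_map_eval γ k, Measure.map_apply (by fun_prop) hI]
      rfl
    rw [this]
    exact ENNReal.mul_pos h1.ne' h2.ne'
  · have : {y : ℕ → ℝ | ∀ j, j ≠ k → y j ∈ S j}
        = ⋂ j, ⋂ (_ : j ∈ ({k}ᶜ : Set ℕ)), (fun y : ℕ → ℝ => y j) ⁻¹' S j := by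
      ext; simp
    rw [this]
    refine MeasurableSet.iInter fun j => MeasurableSet.iInter fun hj => ?_
    refine le_iSup₂ (f := fun (i : ℕ) (_ : i ∈ ({k}ᶜ : Set ℕ)) =>
      MeasurableSpace.comap (fun y : ℕ → ℝ => y i) inferInstance) j hj _ ?_
    exact ⟨S j, hS j, rfl⟩
  · refine le_iSup₂ (f := fun (i : ℕ) (_ : i ∈ ({k} : Set ℕ)) =>
      MeasurableSpace.comap (fun y : ℕ → ℝ => y i) inferInstance) k rfl _ ?_
    exact ⟨I, hI, rfl⟩

lemma gcb_tail (v : ℝ≥0) (c : ℝ) (hc : 0 ≤ c) :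
    gaussianReal 0 v {y | c ≤ |y|} ≤ ENNReal.ofReal (2 * Real.exp (-c ^ 2 / (2 * v))) := by
  have hX : HasSubgaussianMGF id v (gaussianReal 0 v) :=
    ⟨fun t => by simpa using integrable_exp_mul_gaussianReal (μ := 0) (v := v) t,
     fun t => by rw [mgf_id_gaussianReal]; simp⟩
  have h1 := hX.measure_ge_le hc
  have h2 := hX.neg.measure_ge_le hc
  have : {y : ℝ | c ≤ |y|} = {y | c ≤ id y} ∪ {y | c ≤ (-id) y} := by
    ext y; simp [le_abs]
  rw [← ofReal_measureReal]
  apply ENNReal.ofReal_le_ofReal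
  rw [this]
  refine (measureReal_union_le _ _).trans ?_
  linarith

/-- Infinite product positivity. -/
lemma gcb_prod_pos (γ : ℕ → Measure ℝ) [∀ i, IsProbabilityMeasure (γ i)]
    (S : ℕ → Set ℝ) (hS : ∀ i, MeasurableSet (S i)) (hpos : ∀ i, 0 < γ i (S i))
    (hsum : ∑' i, γ i (S i)ᶜ ≠ ∞) :
    0 < Measure.infinitePi γ {y | ∀ k, y k ∈ S k} := by
  have ht := ENNReal.tendsto_sum_nat_add (fun i => γ i (S i)ᶜ) hsum
  obtain ⟨N, hN⟩ := (ht.eventually (gt_mem_nhds (zero_lt_one))).exists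
  have key : ∀ n ≤ N, 0 < Measure.infinitePi γ {y | ∀ k, n ≤ k → y k ∈ S k} := by
    intro n hn
    induction hn using Nat.decreasingInduction with
    | self =>
      rw [pos_iff_ne_zero]
      intro h0
      have hm : MeasurableSet {y : ℕ → ℝ | ∀ k, N ≤ k → y k ∈ S k} := by
        have : {y : ℕ → ℝ | ∀ k, N ≤ k → y k ∈ S k}
          = ⋂ k, ⋂ (_ : N ≤ k), (fun y : ℕ → ℝ => y k) ⁻¹' S k := by ext; simp
        rw [this]
        exact MeasurableSet.iInter fun k => MeasurableSet.iInter fun _ =>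
          measurable_pi_apply k (hS k)
      have h1 : Measure.infinitePi γ {y | ∀ k, N ≤ k → y k ∈ S k}ᶜ = 1 := by
        rw [prob_compl_eq_one_iff hm]; exact h0
      have h2 : {y : ℕ → ℝ | ∀ k, N ≤ k → y k ∈ S k}ᶜ
          ⊆ ⋃ k, (fun y : ℕ → ℝ => y (k + N)) ⁻¹' (S (k + N))ᶜ := by
        intro y hy
        simp only [Set.mem_compl_iff, Set.mem_ofPred_eq, not_forall] at hy
        obtain ⟨k, hk, hy⟩ := hy
        refine Set.mem_iUnion.2 ⟨k - N, ?_⟩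
        simpa [Nat.sub_add_cancel hk] using hy
      have h3 := (measure_mono h2).trans (measure_iUnion_le (μ := Measure.infinitePi γ) _)
      rw [h1] at h3
      refine absurd (h3.trans_lt ?_) (lt_irrefl _)
      convert hN using 3 with k
      conv_rhs => rw [← Measure.infinitePi_map_eval γ (k + N),
        Measure.map_apply (by fun_prop) (hS _).compl]
    | of_succ n hn ih =>
      have h := gcb_pos γ n (fun j => if n + 1 ≤ j then S j else Set.univ) (by
        intro i
        by_cases hi : n + 1 ≤ i
        · simpa [hi] using hS i
        · simp [hi]) (S n) (hS n) (lt_of_lt_of_le ih (measure_mono ?_)) (hpos n)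
      · refine h.trans_le (measure_mono ?_)
        rintro y ⟨h1, h2⟩ k hk
        rcases hk.eq_or_lt with rfl | hk
        · exact h2
        · have := h1 k hk.ne'
          simpa [Nat.succ_le_of_lt hk] using this
      · intro y hy j hj
        by_cases hi : n + 1 ≤ j
        · simpa [hi] using hy j hi
        · simp [hi]
  simpa using key 0 (Nat.zero_le _)

lemma gcb_Ioc (v : ℝ≥0) (hv : v ≠ 0) (s : Set ℝ) (a b : ℝ) (hab : a < b)
    (hs : Set.Ioo a b ⊆ s) : 0 < gaussianReal 0 v s := by
  refine lt_of_lt_of_le ?_ (measure_mono hs)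
  rw [pos_iff_ne_zero]
  intro h
  have := gaussianReal_absolutelyContinuous' 0 hv h
  simp at this
  linarith

theorem gaussian_conditioned_ball_no_maximizer
    (μ₀ : Measure (ℕ → ℝ)) [IsProbabilityMeasure μ₀]
    (hμ₀ : ∀ n : ℕ, Measure.map (fun x (i : Fin n) => x i) μ₀
      = Measure.pi (fun i : Fin n => gaussianReal 0 (1 / ((i : ℕ) + 1 : ℝ≥0) ^ 2)))
    (A : Set (ℕ → ℝ))
    (hA : A = {x : ℕ → ℝ | ∀ k : ℕ, -(1 / Real.sqrt ((k : ℝ) + 1)) ≤ x k})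
    (μ : Measure (ℕ → ℝ)) (hμ : μ = (μ₀ A)⁻¹ • μ₀.restrict A)
    (r : ℝ) (hr : 0 < r) :
    (∀ x : ℕ → ℝ, Tendsto x atTop (nhds 0) →
      0 < μ {y : ℕ → ℝ | ∀ k, |y k - x k| ≤ r} →
      ∃ x' : ℕ → ℝ, Tendsto x' atTop (nhds 0) ∧
        μ {y : ℕ → ℝ | ∀ k, |y k - x k| ≤ r} <
          μ {y : ℕ → ℝ | ∀ k, |y k - x' k| ≤ r}) ∧
    ¬ ∃ x : ℕ → ℝ, Tendsto x atTop (nhds 0) ∧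
        ∀ z : ℕ → ℝ, Tendsto z atTop (nhds 0) →
          μ {y : ℕ → ℝ | ∀ k, |y k - z k| ≤ r} ≤
            μ {y : ℕ → ℝ | ∀ k, |y k - x k| ≤ r} := by
  set γ : ℕ → Measure ℝ := fun i => gaussianReal 0 (1 / ((i : ℕ) + 1 : ℝ≥0) ^ 2) with hγ
  have hv : ∀ i : ℕ, (1 / ((i : ℕ) + 1 : ℝ≥0) ^ 2) ≠ 0 := fun i => by positivity
  have : ∀ i, IsProbabilityMeasure (γ i) := fun i => by
    simp only [hγ]; infer_instance
  have e0 : μ₀ = Measure.infinitePi γ := gcb_eq_infinitePi μ₀ γ hμ₀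
  set a : ℕ → ℝ := fun k => 1 / Real.sqrt ((k : ℝ) + 1) with ha
  have hapos : ∀ k, 0 < a k := fun k => by simp only [ha]; positivity
  have hat : Tendsto a atTop (nhds 0) := by
    have : Tendsto (fun k : ℕ => Real.sqrt ((k : ℝ) + 1)) atTop atTop :=
      Real.tendsto_sqrt_atTop.comp
        (tendsto_atTop_add_const_right _ _ tendsto_natCast_atTop_atTop)
    simp only [ha, one_div]
    exact this.inv_tendsto_atTop
  have hmeas : ∀ x : ℕ → ℝ, MeasurableSet {y : ℕ → ℝ | ∀ k, |y k - x k| ≤ r} := by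
    intro x
    rw [Set.ofPred_forall]
    exact MeasurableSet.iInter fun k => measurableSet_le (by fun_prop) (by fun_prop)
  have hball : ∀ x : ℕ → ℝ, {y : ℕ → ℝ | ∀ k, |y k - x k| ≤ r} ∩ A
      = {y | ∀ k, y k ∈ Set.Icc (x k - r) (x k + r) ∩ Set.Ici (-a k)} := by
    intro x
    ext y
    simp only [hA, Set.mem_inter_iff, Set.mem_ofPred_eq, Set.mem_Icc, Set.mem_Ici, abs_le]
    constructor
    · rintro ⟨h1, h2⟩ k
      exact ⟨⟨by linarith [(h1 k).1], by linarith [(h1 k).2]⟩, h2 k⟩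
    · intro h
      exact ⟨fun k => ⟨by linarith [(h k).1.1], by linarith [(h k).1.2]⟩, fun k => (h k).2⟩
  have hμb : ∀ x : ℕ → ℝ, μ {y : ℕ → ℝ | ∀ k, |y k - x k| ≤ r} = (μ₀ A)⁻¹ *
      μ₀ {y | ∀ k, y k ∈ Set.Icc (x k - r) (x k + r) ∩ Set.Ici (-a k)} := by
    intro x
    rw [hμ, Measure.smul_apply, Measure.restrict_apply (hmeas x), hball, smul_eq_mul]
  have hSm : ∀ (x : ℕ → ℝ) k, MeasurableSet (Set.Icc (x k - r) (x k + r) ∩ Set.Ici (-a k)) :=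
    fun x k => measurableSet_Icc.inter measurableSet_Ici
  -- positivity at the origin
  have hpos0 : 0 < μ₀ {y | ∀ k, y k ∈ Set.Icc ((0 : ℝ) - r) (0 + r) ∩ Set.Ici (-a k)} := by
    rw [e0]
    refine gcb_prod_pos γ (fun k => Set.Icc ((0 : ℝ) - r) (0 + r) ∩ Set.Ici (-a k))
      (fun k => hSm (fun _ => 0) k) ?_ ?_
    · intro i
      refine gcb_Ioc _ (hv i) _ 0 r hr ?_
      intro y hy
      have := hapos i
      exact ⟨⟨by linarith [hy.1], by linarith [hy.2]⟩, by
        simp only [Set.mem_Ici]; linarith [hy.1]⟩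
    · obtain ⟨N, hN⟩ := eventually_atTop.1 (hat.eventually (gt_mem_nhds hr))
      have hs : Summable fun k : ℕ => 2 * Real.exp (-((k : ℝ) + 1) / 2) := by
        have : Summable fun k : ℕ => (2 * Real.exp (-1 / 2)) * Real.exp ((k : ℝ) * (-1 / 2)) :=
          (Real.summable_exp_nat_mul_iff.2 (by norm_num)).mul_left _
        refine this.congr fun k => ?_
        rw [mul_assoc, ← Real.exp_add]
        congr 2; ring
      have hb : ∀ k, γ (k + N) (Set.Icc ((0 : ℝ) - r) (0 + r) ∩ Set.Ici (-a (k + N)))ᶜ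
          ≤ ENNReal.ofReal (2 * Real.exp (-(((k + N : ℕ) : ℝ) + 1) / 2)) := by
        intro k
        have hak := hN (k + N) (by omega)
        have h := gcb_tail (1 / (((k + N : ℕ) : ℕ) + 1 : ℝ≥0) ^ 2) (a (k + N)) (hapos _).le
        refine (measure_mono ?_).trans (h.trans_eq ?_)
        · intro y hy
          by_contra hc
          simp only [Set.mem_ofPred_eq, not_le, abs_lt] at hc
          exact hy ⟨⟨by linarith [hc.1], by linarith [hc.2]⟩, hc.1.le⟩
        · congr 3
          have hp : (0 : ℝ) < ((k + N : ℕ) : ℝ) + 1 := by positivity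
          simp only [ha, div_pow, Real.sq_sqrt hp.le]
          push_cast at hp ⊢
          field_simp
      rw [← Summable.sum_add_tsum_nat_add' (k := N) ENNReal.summable]
      refine ENNReal.add_ne_top.2 ⟨?_, ?_⟩
      · exact ENNReal.sum_ne_top.2 fun i _ => measure_ne_top _ _
      · refine ne_top_of_le_ne_top ?_ (ENNReal.tsum_le_tsum hb)
        exact ((summable_nat_add_iff N).2 hs).tsum_ofReal_ne_top
  have hA0 : μ₀ A ≠ 0 := by
    intro h
    refine hpos0.ne' (measure_mono_null ?_ h)
    intro y hy
    rw [hA]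
    exact fun k => (hy k).2
  have hA1 : (μ₀ A)⁻¹ ≠ 0 := ENNReal.inv_ne_zero.2 (measure_ne_top _ _)
  have hA2 : (μ₀ A)⁻¹ ≠ ∞ := ENNReal.inv_ne_top.2 hA0
  have main : ∀ x : ℕ → ℝ, Tendsto x atTop (nhds 0) →
      0 < μ {y : ℕ → ℝ | ∀ k, |y k - x k| ≤ r} →
      ∃ x' : ℕ → ℝ, Tendsto x' atTop (nhds 0) ∧
        μ {y : ℕ → ℝ | ∀ k, |y k - x k| ≤ r} <
          μ {y : ℕ → ℝ | ∀ k, |y k - x' k| ≤ r} := by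
    intro x hx hp
    have h1 : ∀ᶠ k in atTop, x k + a k < r / 2 := by
      have := hx.add hat
      rw [add_zero] at this
      exact this.eventually (gt_mem_nhds (by positivity))
    have h2 : ∀ᶠ k in atTop, - (r / 2) < x k :=
      hx.eventually (lt_mem_nhds (by linarith))
    obtain ⟨k, hk1, hk2⟩ := (h1.and h2).exists
    have hak := hapos k
    have hxx : ∀ j, j ≠ k → Function.update x k (x k + r / 2) j = x j := fun j hj =>
      Function.update_of_ne hj _ _
    refine ⟨Function.update x k (x k + r / 2), ?_, ?_⟩
    · refine hx.congr' ?_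
      filter_upwards [eventually_gt_atTop k] with j hj
      exact (hxx j hj.ne').symm
    · rw [hμb] at hp
      rw [hμb, hμb]
      refine (ENNReal.mul_lt_mul_iff_right hA1 hA2).2 ?_
      have hp' : 0 < μ₀ {y | ∀ k, y k ∈ Set.Icc (x k - r) (x k + r) ∩ Set.Ici (-a k)} := by
        rw [pos_iff_ne_zero] at hp ⊢
        exact fun h => hp (by rw [h, mul_zero])
      set B := {y : ℕ → ℝ | ∀ k, y k ∈ Set.Icc (x k - r) (x k + r) ∩ Set.Ici (-a k)} with hB
      set D := {y : ℕ → ℝ | ∀ j, j ≠ k → y j ∈ Set.Icc (x j - r) (x j + r) ∩ Set.Ici (-a j)} ∩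
        {y | y k ∈ Set.Ioc (x k + r) (x k + r / 2 + r)} with hD
      have hDpos : 0 < μ₀ D := by
        rw [e0] at hp' ⊢
        refine gcb_pos γ k (fun j => Set.Icc (x j - r) (x j + r) ∩ Set.Ici (-a j)) (hSm x) _
          measurableSet_Ioc (hp'.trans_le (measure_mono fun y hy j _ => hy j)) ?_
        exact gcb_Ioc _ (hv k) _ _ _ (by linarith) Set.Ioo_subset_Ioc_self
      have hBm : MeasurableSet B := by
        rw [hB, Set.ofPred_forall]
        exact MeasurableSet.iInter fun k => measurable_pi_apply k (hSm x k)
      have hdisj : Disjoint D B := by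
        rw [Set.disjoint_left]
        intro y hy hy'
        have := (hy' k).1.2
        have := hy.2.1
        linarith
      calc μ₀ B < μ₀ D + μ₀ B := by
            rw [add_comm]
            exact ENNReal.lt_add_right (measure_ne_top _ _) hDpos.ne'
        _ = μ₀ (D ∪ B) := (measure_union hdisj hBm).symm
        _ ≤ _ := by
            refine measure_mono ?_
            rintro y (hy | hy) j
            · by_cases hj : j = k
              · subst hj
                have h3 := hy.2.1
                have h4 := hy.2.2
                rw [Function.update_self]
                exact ⟨⟨by linarith, h4⟩, by simp only [Set.mem_Ici]; linarith⟩
              · rw [hxx j hj]; exact hy.1 j hj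
            · by_cases hj : j = k
              · subst hj
                have h3 := (hy j).1.2
                have h4 := (hy j).2
                simp only [Set.mem_Ici] at h4
                rw [Function.update_self]
                exact ⟨⟨by linarith, by linarith⟩, h4⟩
              · rw [hxx j hj]; exact hy j
  refine ⟨main, ?_⟩
  rintro ⟨x, hx, hmax⟩
  have hp : 0 < μ {y : ℕ → ℝ | ∀ k, |y k - x k| ≤ r} := by
    refine lt_of_lt_of_le ?_ (hmax (fun _ => 0) tendsto_const_nhds)
    rw [hμb]
    exact ENNReal.mul_pos hA1 hpos0.ne'
  obtain ⟨x', hx', hlt⟩ := main x hx hp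
  exact absurd (hmax x' hx') (not_le.2 hlt)
end
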